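/- arXiv:1411.6786 — 10 statements merged into one kernel-verified Lean document; each statement's English description precedes it below -/
import Mathlib

section
/- Let n ≥ 1 and let A be an n×n complex matrix with eigenvalues λ₁, …, λₙ counted with multiplicity. Then the infimum over g ∈ SL_n(ℂ) of the Frobenius norm ‖g A g⁻¹‖_F equals √(|λ₁|² + ⋯ + |λₙ|²). -/
/-- The Frobenius norm of an `n × n` complex matrix: `(∑ i j, |M i j|²)^(1/2)`. -/
noncomputable def frobeniusNorm {n : ℕ} (M : Matrix (Fin n) (Fin n) ℂ) : ℝ :=
  Real.sqrt (∑ i, ∑ j, ‖M i j‖ ^ 2)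

open Matrix in
lemma schur_aux : ∀ (n : ℕ) (A : Matrix (Fin n) (Fin n) ℂ),
    ∃ U : Matrix (Fin n) (Fin n) ℂ, Uᴴ * U = 1 ∧ ∀ i j, j < i → (Uᴴ * A * U) i j = 0 := by
  intro n
  induction n with
  | zero => intro A; exact ⟨1, by simp, fun i => i.elim0⟩
  | succ n ih =>
    intro A
    obtain ⟨μ, hμ⟩ := Module.End.exists_eigenvalue (Matrix.toLin' A)
    obtain ⟨v, hv⟩ := hμ.exists_hasEigenvector
    have hv1 : A *ᵥ v = μ • v := by simpa using hv.apply_eq_smul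
    have hv0 : v ≠ 0 := hv.2
    have hw0 : WithLp.toLp 2 v ≠ 0 := by
      intro h; apply hv0; simpa using h
    set w : EuclideanSpace ℂ (Fin (n+1)) := ((‖WithLp.toLp 2 v‖ : ℂ)⁻¹) • WithLp.toLp 2 v with hw
    have hwn : ‖w‖ = 1 := by
      rw [hw, norm_smul]
      simp [hw0]
    have hAw : ∀ i, ∑ j, A i j * w j = μ * w i := by
      intro i
      have := congrFun hv1 i
      simp only [mulVec, dotProduct, Pi.smul_apply, smul_eq_mul] at this
      simp only [hw, PiLp.smul_apply, smul_eq_mul]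
      rw [mul_left_comm, ← this, Finset.mul_sum]
      exact Finset.sum_congr rfl fun _ _ => by ring
    obtain ⟨b, hb⟩ := Orthonormal.exists_orthonormalBasis_extension_of_card_eq (𝕜 := ℂ)
      (E := EuclideanSpace ℂ (Fin (n+1))) (ι := Fin (n+1)) (by simp) (v := fun _ => w)
      (s := {0}) (by
        constructor
        · intro i; simpa using hwn
        · intro i j hij; exact absurd (Subsingleton.elim i j) hij)
    have hb0 : b 0 = w := hb 0 (by simp)
    let U : Matrix (Fin (n+1)) (Fin (n+1)) ℂ := Matrix.of fun i j => b j i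
    have hU : Uᴴ * U = 1 := by
      ext i j
      have := orthonormal_iff_ite.1 b.orthonormal i j
      rw [PiLp.inner_apply] at this
      simp only [RCLike.inner_apply] at this
      rw [Matrix.one_apply, ← this, Matrix.mul_apply]
      refine Finset.sum_congr rfl fun k _ => ?_
      simp [U, mul_comm]
    set B := Uᴴ * A * U with hB
    have hB0 : ∀ i : Fin n, B i.succ 0 = 0 := by
      intro i
      have h1 : (A * U) = fun i j => (A * U) i j := rfl
      have h2 : ∀ k, (A * U) k 0 = μ * U k 0 := by
        intro k
        rw [Matrix.mul_apply]
        simpa [U, hb0] using hAw k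
      have h3 : B i.succ 0 = μ * (Uᴴ * U) i.succ 0 := by
        rw [hB, Matrix.mul_assoc, Matrix.mul_apply, Matrix.mul_apply, Finset.mul_sum]
        refine Finset.sum_congr rfl fun k _ => ?_
        rw [h2]; ring
      rw [h3, hU]; simp [Matrix.one_apply]
    obtain ⟨V, hV, hVt⟩ := ih (B.submatrix Fin.succ Fin.succ)
    let W : Matrix (Fin (n+1)) (Fin (n+1)) ℂ :=
      Matrix.of (Fin.cons (Fin.cons 1 0) (fun i => Fin.cons 0 (V i)))
    have W00 : W 0 0 = 1 := rfl
    have W0s : ∀ i : Fin n, W 0 i.succ = 0 := fun i => rfl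
    have Ws0 : ∀ i : Fin n, W i.succ 0 = 0 := fun i => rfl
    have Wss : ∀ i j : Fin n, W i.succ j.succ = V i j := fun i j => rfl
    have hW : Wᴴ * W = 1 := by
      ext i j
      refine Fin.cases ?_ (fun i => ?_) i <;> refine Fin.cases ?_ (fun j => ?_) j
      · simp [Matrix.mul_apply, Fin.sum_univ_succ, W00, W0s, Ws0, Wss]
      · simp [Matrix.mul_apply, Fin.sum_univ_succ, W00, W0s, Ws0, Wss, Matrix.one_apply, (Fin.succ_ne_zero _).symm]
      · simp [Matrix.mul_apply, Fin.sum_univ_succ, W00, W0s, Ws0, Wss, Matrix.one_apply]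
      · have := congrFun (congrFun hV i) j
        simp [Matrix.mul_apply, Matrix.one_apply] at this
        simp [Matrix.mul_apply, Fin.sum_univ_succ, W00, W0s, Ws0, Wss, Matrix.one_apply, this]
    refine ⟨U * W, ?_, ?_⟩
    · rw [conjTranspose_mul, Matrix.mul_assoc, ← Matrix.mul_assoc Uᴴ, hU, Matrix.one_mul, hW]
    · have h4 : (U * W)ᴴ * A * (U * W) = Wᴴ * B * W := by
        rw [conjTranspose_mul, hB]; simp only [Matrix.mul_assoc]
      rw [h4]
      intro i j
      refine Fin.cases ?_ (fun i => ?_) i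
      · intro h; exact absurd h (Fin.not_lt_zero _)
      refine Fin.cases ?_ (fun j => ?_) j
      · intro _
        simp [Matrix.mul_apply, Fin.sum_univ_succ, W00, W0s, Ws0, Wss, hB0]
      · intro h
        have := hVt i j (by simpa using h)
        simp [Matrix.mul_apply] at this
        simp [Matrix.mul_apply, Fin.sum_univ_succ, W0s, Ws0, Wss, this]

open Matrix in
lemma frob_trace {n : ℕ} (M : Matrix (Fin n) (Fin n) ℂ) :
    ((∑ i, ∑ j, ‖M i j‖ ^ 2 : ℝ) : ℂ) = (Mᴴ * M).trace := by
  rw [Finset.sum_comm]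
  simp [Matrix.trace, Matrix.mul_apply, Complex.conj_mul']

open Matrix in
lemma frob_unitary {n : ℕ} (M U : Matrix (Fin n) (Fin n) ℂ) (hU : Uᴴ * U = 1) :
    (∑ i, ∑ j, ‖(Uᴴ * M * U) i j‖ ^ 2) = ∑ i, ∑ j, ‖M i j‖ ^ 2 := by
  have hU' : U * Uᴴ = 1 := mul_eq_one_comm.1 hU
  have : ((∑ i, ∑ j, ‖(Uᴴ * M * U) i j‖ ^ 2 : ℝ) : ℂ) = ((∑ i, ∑ j, ‖M i j‖ ^ 2 : ℝ) : ℂ) := by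
    rw [frob_trace, frob_trace]
    have : (Uᴴ * M * U)ᴴ * (Uᴴ * M * U) = Uᴴ * (Mᴴ * M * U) := by
      simp only [conjTranspose_mul, conjTranspose_conjTranspose, Matrix.mul_assoc]
      rw [← Matrix.mul_assoc U Uᴴ, hU', Matrix.one_mul]
    rw [this, Matrix.trace_mul_comm, Matrix.mul_assoc, hU', Matrix.mul_one]
  exact_mod_cast this

lemma sum_eig {n : ℕ} (T : Matrix (Fin n) (Fin n) ℂ) (lam : Fin n → ℂ)
    (hT : ∀ i j, j < i → T i j = 0)
    (h : T.charpoly = ∏ i, (Polynomial.X - Polynomial.C (lam i))) :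
    ∑ i, ‖T i i‖ ^ 2 = ∑ i, ‖lam i‖ ^ 2 := by
  have h1 : T.charpoly = ∏ i, (Polynomial.X - Polynomial.C (T i i)) :=
    Matrix.charpoly_of_isUpperTriangular T (fun i j hij => hT i j hij)
  have h2 := congrArg Polynomial.roots (h1.symm.trans h)
  have key : ∀ f : Fin n → ℂ, (∏ i, (Polynomial.X - Polynomial.C (f i))).roots
      = Finset.univ.val.map f := by
    intro f
    have := Polynomial.roots_multiset_prod_X_sub_C (Finset.univ.val.map f)
    rw [Multiset.map_map] at this
    exact this
  rw [key, key] at h2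
  have h3 := congrArg (fun s => (Multiset.map (fun z : ℂ => ‖z‖ ^ 2) s).sum) h2
  simp only [Multiset.map_map] at h3
  exact h3

lemma sl_normalize {n : ℕ} (hn : 1 ≤ n) (A P Q : Matrix (Fin n) (Fin n) ℂ) (hPQ : P * Q = 1) :
    ∃ g : Matrix.SpecialLinearGroup (Fin n) ℂ,
      (g : Matrix (Fin n) (Fin n) ℂ) * A *
          ((g⁻¹ : Matrix.SpecialLinearGroup (Fin n) ℂ) : Matrix (Fin n) (Fin n) ℂ) = P * A * Q := by
  have hdet : P.det * Q.det = 1 := by rw [← Matrix.det_mul, hPQ, Matrix.det_one]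
  obtain ⟨c, hc⟩ := IsAlgClosed.exists_pow_nat_eq Q.det (n := n) (by omega)
  have hc0 : c ≠ 0 := by
    rintro rfl
    rw [zero_pow (by omega)] at hc
    simp [← hc] at hdet
  let g : Matrix.SpecialLinearGroup (Fin n) ℂ :=
    ⟨c • P, by rw [Matrix.det_smul, Fintype.card_fin, hc, mul_comm, hdet]⟩
  have hg : (g : Matrix (Fin n) (Fin n) ℂ) = c • P := rfl
  have hgi : ((g⁻¹ : Matrix.SpecialLinearGroup (Fin n) ℂ) : Matrix (Fin n) (Fin n) ℂ)
      = c⁻¹ • Q := by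
    have h1 : ((g⁻¹ : Matrix.SpecialLinearGroup (Fin n) ℂ) : Matrix (Fin n) (Fin n) ℂ) * g = 1 := by
      rw [← Matrix.SpecialLinearGroup.coe_mul]; simp
    have h2 : (g : Matrix (Fin n) (Fin n) ℂ) * (c⁻¹ • Q) = 1 := by
      rw [hg]; simp [smul_smul, hc0, hPQ]
    exact left_inv_eq_right_inv h1 h2
  refine ⟨g, ?_⟩
  rw [hgi, hg]
  simp [smul_smul, hc0]

lemma charpoly_conj' {n : ℕ} (A P Q : Matrix (Fin n) (Fin n) ℂ) (hPQ : P * Q = 1) :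
    (P * A * Q).charpoly = A.charpoly := by
  rw [Matrix.charpoly_mul_comm, ← Matrix.mul_assoc, mul_eq_one_comm.1 hPQ, Matrix.one_mul]

/-- Let `n ≥ 1` and let `A` be an `n × n` complex matrix with eigenvalues `λ₁, …, λₙ` counted
with multiplicity (i.e. the characteristic polynomial of `A` is `∏ i (X - λᵢ)`). Then the
infimum over `g ∈ SL_n(ℂ)` of the Frobenius norm of `g A g⁻¹` equals
`√(|λ₁|² + ⋯ + |λₙ|²)`. -/
theorem inf_frobeniusNorm_conj_eq_sqrt_sum_sq_eigenvalues
    (n : ℕ) (hn : 1 ≤ n) (A : Matrix (Fin n) (Fin n) ℂ) (lam : Fin n → ℂ)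
    (hA : A.charpoly = ∏ i, (Polynomial.X - Polynomial.C (lam i))) :
    sInf {x : ℝ | ∃ g : Matrix.SpecialLinearGroup (Fin n) ℂ,
        x = frobeniusNorm ((g : Matrix (Fin n) (Fin n) ℂ) * A *
          ((g⁻¹ : Matrix.SpecialLinearGroup (Fin n) ℂ) : Matrix (Fin n) (Fin n) ℂ))} =
      Real.sqrt (∑ i, ‖lam i‖ ^ 2) := by
  apply le_antisymm
  · obtain ⟨U, hU, hT⟩ := schur_aux n A
    set T := U.conjTranspose * A * U with hTdef
    have hch : T.charpoly = _ := (charpoly_conj' A U.conjTranspose U hU).trans hA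
    rw [← sum_eig T lam hT hch]
    let F : ℝ → ℝ := fun s => Real.sqrt (∑ i : Fin n, ∑ j : Fin n,
      ‖((s : ℂ) ^ ((j : ℕ) - (i : ℕ))) * T i j‖ ^ 2)
    have hF : Continuous F := by
      unfold F; fun_prop
    have hF0 : F 0 = Real.sqrt (∑ i, ‖T i i‖ ^ 2) := by
      unfold F
      congr 1
      refine Finset.sum_congr rfl fun i _ => ?_
      rw [Finset.sum_eq_single i]
      · simp
      · intro j _ hj
        rcases lt_or_gt_of_ne hj with h | h
        · simp [hT i j h]
        · have : (j : ℕ) - (i : ℕ) ≠ 0 := by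
            have : (i : ℕ) < j := h
            omega
          simp [this]
      · simp
    rw [← hF0]
    have ht : Filter.Tendsto F (nhdsWithin 0 {0}ᶜ) (nhds (F 0)) :=
      hF.continuousAt.tendsto.mono_left nhdsWithin_le_nhds
    refine ge_of_tendsto ht ?_
    filter_upwards [self_mem_nhdsWithin] with s hs
    have hs0 : (s : ℂ) ≠ 0 := by
      simpa using hs
    apply csInf_le
    · refine ⟨0, ?_⟩
      rintro x ⟨g, rfl⟩
      exact Real.sqrt_nonneg _
    · let D : Matrix (Fin n) (Fin n) ℂ := Matrix.diagonal fun i => (s : ℂ) ^ (i : ℕ)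
      let D' : Matrix (Fin n) (Fin n) ℂ := Matrix.diagonal fun i => ((s : ℂ) ^ (i : ℕ))⁻¹
      have hDD : D' * D = 1 := by
        simp [D, D', Matrix.diagonal_mul_diagonal, hs0]
      obtain ⟨g, hg⟩ := sl_normalize hn A (D' * U.conjTranspose) (U * D) (by
        rw [Matrix.mul_assoc, ← Matrix.mul_assoc U.conjTranspose, hU, Matrix.one_mul, hDD])
      refine ⟨g, ?_⟩
      have h5 : D' * U.conjTranspose * A * (U * D) = D' * T * D := by
        rw [hTdef]; simp only [Matrix.mul_assoc]
      rw [hg, h5]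
      unfold F frobeniusNorm
      congr 1
      refine Finset.sum_congr rfl fun i _ => Finset.sum_congr rfl fun j _ => ?_
      congr 2
      simp only [D, D', Matrix.mul_diagonal, Matrix.diagonal_mul]
      rcases lt_or_ge j i with h | h
      · simp [hT i j h]
      · have h' : (i : ℕ) ≤ j := h
        rw [pow_sub₀ _ hs0 h']
        ring
  · apply le_csInf
    · exact ⟨_, 1, rfl⟩
    · rintro x ⟨g, rfl⟩
      have hgg : (g : Matrix (Fin n) (Fin n) ℂ) *
          ((g⁻¹ : Matrix.SpecialLinearGroup (Fin n) ℂ) : Matrix (Fin n) (Fin n) ℂ) = 1 := by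
        rw [← Matrix.SpecialLinearGroup.coe_mul]; simp
      have hch := (charpoly_conj' A _ _ hgg).trans hA
      generalize (g : Matrix (Fin n) (Fin n) ℂ) * A *
          ((g⁻¹ : Matrix.SpecialLinearGroup (Fin n) ℂ) : Matrix (Fin n) (Fin n) ℂ) = M at hch ⊢
      obtain ⟨U, hU, hT⟩ := schur_aux n M
      rw [← sum_eig _ lam hT ((charpoly_conj' M _ _ hU).trans hch)]
      unfold frobeniusNorm
      rw [← frob_unitary M U hU]
      apply Real.sqrt_le_sqrt
      refine Finset.sum_le_sum fun i _ => ?_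
      exact Finset.single_le_sum
        (f := fun j => ‖(U.conjTranspose * M * U) i j‖ ^ 2)
        (fun j _ => by positivity) (Finset.mem_univ i)
end

section
/- Let n ≥ 1, let λ₁, …, λₙ ∈ ℂ and let D = diag(λ₁, …, λₙ) be the corresponding diagonal n×n matrix. Then for every g ∈ SL_n(ℂ) one has ‖g D g⁻¹‖_F ≥ ‖D‖_F = √(|λ₁|² + ⋯ + |λₙ|²); that is, the diagonal matrix D is minimal for the Frobenius norm in its SL_n(ℂ)-conjugation orbit. -/
open InnerProductSpace in
/-- An orthonormal basis obtained from an eigenbasis by Gram-Schmidt has the eigenvalues as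
diagonal coefficients. -/
lemma gs_inner_eq {n : ℕ} {E : Type*} [NormedAddCommGroup E] [InnerProductSpace ℂ E]
    (v : Fin n → E) (hv : LinearIndependent ℂ v) (lam : Fin n → ℂ)
    (T : E →ₗ[ℂ] E) (hT : ∀ i, T (v i) = lam i • v i) (i : Fin n) :
    inner ℂ (gramSchmidtNormed ℂ v i) (T (gramSchmidtNormed ℂ v i)) = lam i := by
  have key : ∀ x ∈ Submodule.span ℂ (v '' Set.Iic i),
      inner ℂ (gramSchmidtNormed ℂ v i) (T x - lam i • x) = 0 := by
    intro x hx
    induction hx using Submodule.span_induction with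
    | mem x hx =>
      obtain ⟨j, hj, rfl⟩ := hx
      rw [hT, ← sub_smul, inner_smul_right]
      rcases (Set.mem_Iic.1 hj).eq_or_lt with h | h
      · simp [h]
      · simp [gramSchmidtNormed, inner_smul_left, gramSchmidt_inv_triangular ℂ v h]
    | zero => simp
    | add x y _ _ hx hy =>
      have : T (x + y) - lam i • (x + y) = (T x - lam i • x) + (T y - lam i • y) := by
        rw [map_add, smul_add]; abel
      rw [this, inner_add_right, hx, hy, add_zero]
    | smul a x _ hx =>
      have : T (a • x) - lam i • (a • x) = a • (T x - lam i • x) := by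
        rw [map_smul, smul_sub, smul_comm]
      rw [this, inner_smul_right, hx, mul_zero]
  have h := key (gramSchmidtNormed ℂ v i)
    (Submodule.smul_mem _ _ (gramSchmidt_mem_span ℂ v le_rfl))
  rw [inner_sub_right, inner_smul_right, inner_self_eq_norm_sq_to_K,
    gramSchmidtNormed_unit_length i hv] at h
  simpa [sub_eq_zero] using h

/-- The squared Frobenius norm is computed by any orthonormal basis. -/
lemma sum_norm_sq_toEuclideanLin {n : ℕ} (A : Matrix (Fin n) (Fin n) ℂ)
    (b : OrthonormalBasis (Fin n) ℂ (EuclideanSpace ℂ (Fin n))) :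
    ∑ i, ‖Matrix.toEuclideanLin A (b i)‖ ^ 2 = ∑ k, ∑ j, ‖A k j‖ ^ 2 := by
  have h1 : ∀ i, ‖Matrix.toEuclideanLin A (b i)‖ ^ 2 =
      ∑ k, ‖inner ℂ (WithLp.toLp 2 (fun j => star (A k j)) : EuclideanSpace ℂ (Fin n))
        (b i)‖ ^ 2 := by
    intro i
    rw [EuclideanSpace.norm_sq_eq]
    refine Finset.sum_congr rfl fun k _ => ?_
    congr 2
    simp [PiLp.inner_apply, Matrix.toLpLin_apply, Matrix.mulVec, dotProduct, mul_comm]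
  simp_rw [h1]
  rw [Finset.sum_comm]
  refine Finset.sum_congr rfl fun k _ => ?_
  rw [b.sum_sq_norm_inner_left, EuclideanSpace.norm_sq_eq]
  simp

/-- Let `n ≥ 1`, `λ₁, …, λₙ ∈ ℂ` and `D = diag(λ₁, …, λₙ)`.  Then for every `g ∈ SL_n(ℂ)` one
has `‖g D g⁻¹‖_F ≥ ‖D‖_F = √(|λ₁|² + ⋯ + |λₙ|²)`: the diagonal matrix `D` is minimal for the
Frobenius norm in its `SL_n(ℂ)`-conjugation orbit. -/
theorem diagonal_minimal_frobeniusNorm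
    (n : ℕ) (hn : 1 ≤ n) (lam : Fin n → ℂ) (g : Matrix.SpecialLinearGroup (Fin n) ℂ) :
    frobeniusNorm ((g : Matrix (Fin n) (Fin n) ℂ) * Matrix.diagonal lam *
        ((g⁻¹ : Matrix.SpecialLinearGroup (Fin n) ℂ) : Matrix (Fin n) (Fin n) ℂ)) ≥
      frobeniusNorm (Matrix.diagonal lam) ∧
    frobeniusNorm (Matrix.diagonal lam) = Real.sqrt (∑ i, ‖lam i‖ ^ 2) := by
  have hD : frobeniusNorm (Matrix.diagonal lam) = Real.sqrt (∑ i, ‖lam i‖ ^ 2) := by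
    unfold frobeniusNorm
    congr 1
    refine Finset.sum_congr rfl fun i _ => ?_
    rw [Finset.sum_eq_single i]
    · simp
    · intro j _ hj
      simp [Matrix.diagonal_apply_ne lam hj.symm]
    · simp
  refine ⟨?_, hD⟩
  rw [hD, ge_iff_le]
  unfold frobeniusNorm
  apply Real.sqrt_le_sqrt
  set G : Matrix (Fin n) (Fin n) ℂ := (g : Matrix (Fin n) (Fin n) ℂ) with hG
  set H : Matrix (Fin n) (Fin n) ℂ :=
    ((g⁻¹ : Matrix.SpecialLinearGroup (Fin n) ℂ) : Matrix (Fin n) (Fin n) ℂ) with hH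
  have hHG : H * G = 1 := by
    rw [hG, hH, ← Matrix.SpecialLinearGroup.coe_mul, inv_mul_cancel,
      Matrix.SpecialLinearGroup.coe_one]
  let v : Fin n → EuclideanSpace ℂ (Fin n) := fun i => WithLp.toLp 2 (G.col i)
  have hv : LinearIndependent ℂ v := by
    have hu : IsUnit G := (Matrix.isUnit_iff_isUnit_det G).2 (by simp [hG])
    have h0 := Matrix.linearIndependent_cols_of_isUnit hu
    exact h0.map' (WithLp.linearEquiv 2 ℂ (Fin n → ℂ)).symm.toLinearMap (LinearEquiv.ker _)
  have hT : ∀ i, Matrix.toEuclideanLin (G * Matrix.diagonal lam * H) (v i) = lam i • v i := by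
    intro i
    have h1 : (G * Matrix.diagonal lam * H) * G = G * Matrix.diagonal lam := by
      rw [Matrix.mul_assoc, hHG, Matrix.mul_one]
    ext k
    have h2 := congrFun (congrFun h1 k) i
    rw [Matrix.mul_diagonal, Matrix.mul_apply] at h2
    simpa [v, Matrix.mul_assoc, Matrix.toLpLin_apply, Matrix.mulVec, dotProduct, mul_comm] using h2
  let b := InnerProductSpace.gramSchmidtOrthonormalBasis (𝕜 := ℂ)
    (by simp : Module.finrank ℂ (EuclideanSpace ℂ (Fin n)) = Fintype.card (Fin n)) v
  have hb : ∀ i, b i = InnerProductSpace.gramSchmidtNormed ℂ v i := by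
    intro i
    apply InnerProductSpace.gramSchmidtOrthonormalBasis_apply
    intro h0
    have := InnerProductSpace.gramSchmidtNormed_unit_length i hv
    simp [h0] at this
  rw [← sum_norm_sq_toEuclideanLin _ b]
  refine Finset.sum_le_sum fun i _ => ?_
  have h3 := gs_inner_eq v hv lam _ hT i
  rw [← hb] at h3
  have h4 := norm_inner_le_norm (𝕜 := ℂ) (b i)
    (Matrix.toEuclideanLin (G * Matrix.diagonal lam * H) (b i))
  rw [h3, b.orthonormal.1 i, one_mul] at h4
  gcongr
end

section
/- Let n ≥ 1 and let A be an n×n complex matrix with eigenvalues λ₁, …, λₙ counted with multiplicity. Then the infimum over g ∈ SL_n(ℂ) of the L² operator norm ‖g A g⁻¹‖_op equals max{|λ₁|, …, |λₙ|}. -/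
/-- The `L²` operator norm of an `n × n` complex matrix, i.e. the operator norm of the
associated linear endomorphism of the Hermitian space `ℂⁿ`. -/
noncomputable def l2OperatorNorm {n : ℕ} (M : Matrix (Fin n) (Fin n) ℂ) : ℝ :=
  ‖LinearMap.toContinuousLinearMap (Matrix.toEuclideanLin M)‖

open scoped Matrix.Norms.L2Operator ComplexOrder MatrixOrder Matrix in
/-- Renormalisation: if some positive power of `B` is a contraction, `B` is conjugate to a
contraction. -/
theorem exists_conj_contraction {n : ℕ} (hn : 1 ≤ n) (B : Matrix (Fin n) (Fin n) ℂ) (m : ℕ)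
    (hB : ‖B ^ (m + 1)‖ ≤ 1) :
    ∃ g : Matrix.SpecialLinearGroup (Fin n) ℂ,
      ‖(g : Matrix (Fin n) (Fin n) ℂ) * B * (g : Matrix (Fin n) (Fin n) ℂ).adjugate‖ ≤ 1 := by
  let Φ := Matrix.toEuclideanCLM (𝕜 := ℂ) (n := Fin n)
  have key : ∀ (M : Matrix (Fin n) (Fin n) ℂ) (x), ‖Φ M x‖ ^ 2
      = RCLike.re (inner ℂ (Φ (star M * M) x) x) := by
    intro M x
    rw [ContinuousLinearMap.apply_norm_sq_eq_inner_adjoint_left, map_mul, map_star]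
    rfl
  let P : Matrix (Fin n) (Fin n) ℂ := ∑ k ∈ Finset.range (m + 1), star (B ^ k) * B ^ k
  have hP : P.PosDef := by
    simp only [P, Finset.sum_range_succ', pow_zero, star_one, mul_one]
    rw [add_comm]
    refine Matrix.PosDef.one.add_posSemidef (Matrix.posSemidef_sum _ fun i _ => ?_)
    exact Matrix.posSemidef_conjTranspose_mul_self _
  obtain ⟨b, hb⟩ := CStarAlgebra.nonneg_iff_eq_star_mul_self.1 hP.posSemidef.nonneg
  have hdet : b.det ≠ 0 := by
    intro h
    have := hP.det_pos
    rw [hb, Matrix.det_mul, h, mul_zero] at this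
    exact lt_irrefl _ this
  have hbx : ∀ x, ‖Φ b x‖ ^ 2 = ∑ k ∈ Finset.range (m + 1), ‖Φ (B ^ k) x‖ ^ 2 := by
    intro x
    rw [key, ← hb]
    simp only [P, map_sum, key, ContinuousLinearMap.sum_apply, sum_inner]
  have hstep : ∀ x, ‖Φ b (Φ B x)‖ ≤ ‖Φ b x‖ := by
    intro x
    refine le_of_sq_le_sq ?_ (norm_nonneg _)
    rw [hbx, hbx]
    have e : ∀ k, Φ (B ^ k) (Φ B x) = Φ (B ^ (k + 1)) x := by
      intro k
      rw [pow_succ, map_mul]; rfl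
    simp only [e]
    rw [Finset.sum_range_succ, Finset.sum_range_succ' (fun k => ‖Φ (B ^ k) x‖ ^ 2)]
    gcongr
    calc ‖Φ (B ^ (m + 1)) x‖ ≤ ‖Φ (B ^ (m + 1))‖ * ‖x‖ := ContinuousLinearMap.le_opNorm _ _
      _ ≤ 1 * ‖x‖ := by gcongr; exact hB
      _ = ‖Φ (B ^ 0) x‖ := by simp
  obtain ⟨c, hc⟩ := IsAlgClosed.exists_pow_nat_eq b.det (n := n) (by omega)
  have hc0 : c ≠ 0 := by
    rintro rfl
    rw [zero_pow (by omega)] at hc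
    exact hdet hc.symm
  let g : Matrix.SpecialLinearGroup (Fin n) ℂ := ⟨c⁻¹ • b, by
    rw [Matrix.det_smul, Fintype.card_fin, ← hc, inv_pow, inv_mul_cancel₀ (pow_ne_zero _ hc0)]⟩
  refine ⟨g, ?_⟩
  have hg : (g : Matrix (Fin n) (Fin n) ℂ) = c⁻¹ • b := rfl
  have hgi : (g : Matrix (Fin n) (Fin n) ℂ) * (g : Matrix (Fin n) (Fin n) ℂ).adjugate = 1 := by
    rw [Matrix.mul_adjugate, g.det_coe, one_smul]
  rw [← Matrix.l2_opNorm_toEuclideanCLM]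
  refine ContinuousLinearMap.opNorm_le_bound _ zero_le_one fun y => ?_
  change ‖Φ _ y‖ ≤ _
  set x := Φ (g : Matrix (Fin n) (Fin n) ℂ).adjugate y with hx
  have hy : Φ (g : Matrix (Fin n) (Fin n) ℂ) x = y := by
    have : Φ (g : Matrix (Fin n) (Fin n) ℂ) x =
      Φ ((g : Matrix (Fin n) (Fin n) ℂ) * (g : Matrix (Fin n) (Fin n) ℂ).adjugate) y := by
      rw [map_mul]; rfl
    rw [this, hgi, map_one]; rfl
  have h1 : Φ ((g : Matrix (Fin n) (Fin n) ℂ) * B * (g : Matrix (Fin n) (Fin n) ℂ).adjugate) y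
      = c⁻¹ • Φ b (Φ B x) := by
    rw [map_mul, map_mul, hg, map_smul]; rfl
  have h2 : y = c⁻¹ • Φ b x := by
    conv_lhs => rw [← hy, hg, map_smul]
    rfl
  rw [h1, one_mul]
  conv_rhs => rw [h2]
  rw [norm_smul, norm_smul]
  gcongr
  exact hstep x

open scoped Matrix.Norms.L2Operator in
theorem l2OperatorNorm_eq {n : ℕ} (M : Matrix (Fin n) (Fin n) ℂ) : l2OperatorNorm M = ‖M‖ := rfl

open scoped Matrix.Norms.L2Operator in
theorem exists_pow_norm_le {n : ℕ} (A : Matrix (Fin n) (Fin n) ℂ) (r : NNReal)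
    (hA : spectralRadius ℂ A < r) : ∃ m : ℕ, ‖A ^ (m + 1)‖ ≤ (r : ℝ) ^ (m + 1) := by
  have h := spectrum.pow_nnnorm_pow_one_div_tendsto_nhds_spectralRadius A
  obtain ⟨m, hm, hm0⟩ := ((h.eventually (gt_mem_nhds hA)).and
    (Filter.eventually_gt_atTop 0)).exists
  obtain ⟨k, rfl⟩ : ∃ k, m = k + 1 := ⟨m - 1, by omega⟩
  refine ⟨k, ?_⟩
  rw [one_div, ENNReal.rpow_inv_lt_iff (by positivity), ENNReal.rpow_natCast] at hm
  have h3 : ‖A ^ (k + 1)‖₊ < r ^ (k + 1) := by exact_mod_cast hm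
  exact_mod_cast h3.le

open scoped Matrix.Norms.L2Operator in
/-- Let `n ≥ 1` and let `A` be an `n × n` complex matrix with eigenvalues `λ₁, …, λₙ` counted
with multiplicity (i.e. the characteristic polynomial of `A` is `∏ i (X - λᵢ)`).  Then the
infimum over `g ∈ SL_n(ℂ)` of the `L²` operator norm of `g A g⁻¹` equals
`max {|λ₁|, …, |λₙ|}`. -/
theorem inf_l2OperatorNorm_conj_eq_max_abs_eigenvalues
    (n : ℕ) (hn : 1 ≤ n) (A : Matrix (Fin n) (Fin n) ℂ) (lam : Fin n → ℂ)
    (hA : A.charpoly = ∏ i, (Polynomial.X - Polynomial.C (lam i))) :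
    sInf {x : ℝ | ∃ g : Matrix.SpecialLinearGroup (Fin n) ℂ,
        x = l2OperatorNorm ((g : Matrix (Fin n) (Fin n) ℂ) * A *
          ((g⁻¹ : Matrix.SpecialLinearGroup (Fin n) ℂ) : Matrix (Fin n) (Fin n) ℂ))} =
      ⨆ i : Fin n, ‖lam i‖ := by
  have hroot : ∀ z, z ∈ spectrum ℂ A ↔ ∃ i, z = lam i := by
    intro z
    rw [Matrix.mem_spectrum_iff_isRoot_charpoly, hA, Polynomial.IsRoot.def, Polynomial.eval_prod,
      Finset.prod_eq_zero_iff]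
    simp [sub_eq_zero]
  haveI : Nonempty (Fin n) := ⟨⟨0, by omega⟩⟩
  have hbdd : BddAbove (Set.range fun i : Fin n => ‖lam i‖) := (Set.finite_range _).bddAbove
  simp only [l2OperatorNorm_eq, Matrix.SpecialLinearGroup.coe_inv]
  refine csInf_eq_of_forall_ge_of_forall_gt_exists_lt ⟨_, 1, rfl⟩ ?_ ?_
  · rintro x ⟨g, rfl⟩
    refine ciSup_le fun i => ?_
    apply spectrum.norm_le_norm_of_mem (𝕜 := ℂ)
    let u : (Matrix (Fin n) (Fin n) ℂ)ˣ :=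
      ⟨g, (g : Matrix (Fin n) (Fin n) ℂ).adjugate,
        by rw [Matrix.mul_adjugate, g.det_coe, one_smul],
        by rw [Matrix.adjugate_mul, g.det_coe, one_smul]⟩
    have := spectrum.units_conjugate (R := ℂ) (a := A) (u := u)
    change lam i ∈ spectrum ℂ ((u : Matrix (Fin n) (Fin n) ℂ) * A * ((u⁻¹ : _ˣ) : Matrix _ _ ℂ))
    rw [this]
    exact (hroot _).2 ⟨i, rfl⟩
  · intro w hw
    obtain ⟨r, hr1, hr2⟩ := exists_between hw
    have hr0 : 0 < r := lt_of_le_of_lt (Real.iSup_nonneg fun i => norm_nonneg _) hr1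
    obtain ⟨q, hq1, hq2⟩ := exists_between hr1
    have hq0 : 0 ≤ q := le_trans (Real.iSup_nonneg fun i => norm_nonneg _) hq1.le
    lift r to NNReal using hr0.le
    lift q to NNReal using hq0
    have hsr : spectralRadius ℂ A < r := by
      refine lt_of_le_of_lt (b := (q : ENNReal)) ?_ (by exact_mod_cast hq2)
      refine iSup₂_le fun z hz => ?_
      obtain ⟨i, rfl⟩ := (hroot z).1 hz
      have : ‖lam i‖ ≤ (q : ℝ) := (le_ciSup hbdd i).trans hq1.le
      exact_mod_cast this
    obtain ⟨m, hm⟩ := exists_pow_norm_le A r hsr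
    have hrc : ((r : ℝ) : ℂ) ≠ 0 := by exact_mod_cast hr0.ne'
    obtain ⟨g, hg⟩ := exists_conj_contraction hn (((r : ℝ) : ℂ)⁻¹ • A) m (by
      rw [smul_pow, norm_smul, norm_pow, norm_inv, Complex.norm_real, Real.norm_of_nonneg hr0.le,
        inv_pow]
      exact inv_mul_le_one_of_le₀ hm (by positivity))
    refine ⟨_, ⟨g, rfl⟩, lt_of_le_of_lt ?_ hr2⟩
    rw [Matrix.mul_smul, Matrix.smul_mul, norm_smul, norm_inv, Complex.norm_real,
      Real.norm_of_nonneg hr0.le, inv_mul_le_iff₀ hr0, mul_one] at hg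
    exact hg
end

section
/- Let A be an n×n complex matrix. Then there exists d : {1,…,n} → ℂ such that the characteristic polynomial of A equals ∏ᵢ (X − dᵢ), and the diagonal matrix diag(d₁, …, dₙ) belongs to the closure (for the usual topology on the space of n×n complex matrices) of the conjugation orbit {g A g⁻¹ : g ∈ SL_n(ℂ)} of A. -/
open Matrix in
lemma tri_aux (n : ℕ) : ∀ A : Matrix (Fin n) (Fin n) ℂ,
    ∃ P Q : Matrix (Fin n) (Fin n) ℂ, P * Q = 1 ∧ ∀ i j, j < i → (P * A * Q) i j = 0 := by
  induction n with
  | zero => exact fun A => ⟨1, 1, by simp, fun i => i.elim0⟩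
  | succ n ih =>
    intro A
    obtain ⟨μ, hμ⟩ := Module.End.exists_eigenvalue (Matrix.toLin' A)
    obtain ⟨v, hv⟩ := hμ.exists_hasEigenvector
    have hv1 : A *ᵥ v = μ • v := by simpa using hv.apply_eq_smul
    have he : (Pi.single 0 1 : Fin (n+1) → ℂ) ≠ 0 := by simp
    obtain ⟨L, hL⟩ := SeparatingDual.exists_continuousLinearEquiv_apply_eq (R := ℂ) he hv.2
    let R : Matrix (Fin (n+1)) (Fin (n+1)) ℂ := LinearMap.toMatrix' (L : (Fin (n+1) → ℂ) →ₗ[ℂ] _)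
    let S : Matrix (Fin (n+1)) (Fin (n+1)) ℂ :=
      LinearMap.toMatrix' (L.symm : (Fin (n+1) → ℂ) →ₗ[ℂ] _)
    have hSR : S * R = 1 := by
      rw [← LinearMap.toMatrix'_comp, ← LinearMap.toMatrix'_id]
      congr 1
      ext x
      simp
    have hR : R *ᵥ Pi.single 0 1 = v := by
      rw [LinearMap.toMatrix'_mulVec]; simpa using hL
    have hS : S *ᵥ v = Pi.single 0 1 := by
      rw [← hR, mulVec_mulVec, hSR, one_mulVec]
    set B := S * A * R with hB
    have hB0 : B *ᵥ Pi.single 0 1 = μ • Pi.single 0 1 := by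
      rw [hB, ← mulVec_mulVec, hR, ← mulVec_mulVec, hv1, mulVec_smul, hS]
    have hBc : ∀ i : Fin n, B i.succ 0 = 0 := by
      intro i
      have := congrFun hB0 i.succ
      simpa using this
    obtain ⟨E, F, hEF, hU⟩ := ih (Matrix.of fun i j => B i.succ j.succ)
    let ext' : Matrix (Fin n) (Fin n) ℂ → Matrix (Fin (n+1)) (Fin (n+1)) ℂ := fun Q =>
      Matrix.of (Fin.cons (Fin.cons 1 0) (fun i => Fin.cons 0 (Q i)))
    refine ⟨ext' E * S, R * ext' F, ?_, ?_⟩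
    · have : ext' E * S * (R * ext' F) = ext' E * (S * R) * ext' F := by
        simp only [Matrix.mul_assoc]
      rw [this, hSR, Matrix.mul_one]
      ext i j
      have h := fun i j => congrFun (congrFun hEF i) j
      simp only [Matrix.mul_apply] at h
      refine Fin.cases ?_ (fun i => ?_) i <;> refine Fin.cases ?_ (fun j => ?_) j <;>
        simp [ext', Matrix.mul_apply, Fin.sum_univ_succ, h, Matrix.one_apply, Fin.ext_iff]
    · have : ext' E * S * A * (R * ext' F) = ext' E * B * ext' F := by
        simp only [hB, Matrix.mul_assoc]
      rw [this]
      simp only [Matrix.mul_apply, Matrix.of_apply] at hU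
      intro i j
      refine Fin.cases ?_ (fun i => ?_) i <;> refine Fin.cases ?_ (fun j => ?_) j
      · simp
      · simp
      · simp [ext', Matrix.mul_apply, Fin.sum_univ_succ, hBc]
      · intro hij
        have := hU i j (by simpa using hij)
        simpa [ext', Matrix.mul_apply, Fin.sum_univ_succ, hBc] using this

lemma sl_aux (n : ℕ) (A g h : Matrix (Fin n) (Fin n) ℂ) (hgh : g * h = 1) :
    ∃ s : Matrix.SpecialLinearGroup (Fin n) ℂ,
            g * A * h = (s : Matrix (Fin n) (Fin n) ℂ) * A *
              ((s⁻¹ : Matrix.SpecialLinearGroup (Fin n) ℂ) : Matrix (Fin n) (Fin n) ℂ) := by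
  have hd : g.det * h.det = 1 := by rw [← Matrix.det_mul, hgh, Matrix.det_one]
  have hc : ∃ c : ℂ, c ≠ 0 ∧ c ^ n * g.det = 1 := by
    rcases Nat.eq_zero_or_pos n with rfl | hn
    · exact ⟨1, one_ne_zero, by simp⟩
    · obtain ⟨c, hc⟩ := IsAlgClosed.exists_pow_nat_eq h.det hn
      refine ⟨c, ?_, by rw [hc, mul_comm, hd]⟩
      rintro rfl
      rw [zero_pow hn.ne'] at hc
      simp [← hc] at hd
  obtain ⟨c, hc0, hc⟩ := hc
  let s : Matrix.SpecialLinearGroup (Fin n) ℂ := ⟨c • g, by simpa [Matrix.det_smul] using hc⟩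
  have hs : (s : Matrix (Fin n) (Fin n) ℂ) = c • g := rfl
  have h1 : ((s⁻¹ : Matrix.SpecialLinearGroup (Fin n) ℂ) : Matrix (Fin n) (Fin n) ℂ)
      * (s : Matrix (Fin n) (Fin n) ℂ) = 1 := by
    rw [← Matrix.SpecialLinearGroup.coe_mul, inv_mul_cancel, Matrix.SpecialLinearGroup.coe_one]
  have h2 : (s : Matrix (Fin n) (Fin n) ℂ) * (c⁻¹ • h) = 1 := by
    rw [hs, Matrix.smul_mul, Matrix.mul_smul, smul_smul, mul_inv_cancel₀ hc0, hgh, one_smul]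
  refine ⟨s, ?_⟩
  rw [left_inv_eq_right_inv h1 h2, hs]
  simp [smul_smul, hc0]

/-- Let `A` be an `n × n` complex matrix.  Then there exists `d : Fin n → ℂ` such that the
characteristic polynomial of `A` equals `∏ i (X - dᵢ)` and the diagonal matrix
`diag(d₁, …, dₙ)` belongs to the closure (for the usual topology on `n × n` complex matrices)
of the `SL_n(ℂ)`-conjugation orbit `{g A g⁻¹ : g ∈ SL_n(ℂ)}` of `A`. -/
theorem diagonal_eigenvalues_mem_closure_SL_orbit
    (n : ℕ) (A : Matrix (Fin n) (Fin n) ℂ) :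
    ∃ d : Fin n → ℂ,
      A.charpoly = ∏ i, (Polynomial.X - Polynomial.C (d i)) ∧
      Matrix.diagonal d ∈
        closure {M : Matrix (Fin n) (Fin n) ℂ |
          ∃ g : Matrix.SpecialLinearGroup (Fin n) ℂ,
            M = (g : Matrix (Fin n) (Fin n) ℂ) * A *
              ((g⁻¹ : Matrix.SpecialLinearGroup (Fin n) ℂ) : Matrix (Fin n) (Fin n) ℂ)} := by
  obtain ⟨P, Q, hPQ, hT⟩ := tri_aux n A
  set T := P * A * Q with hTdef
  have hQP : Q * P = 1 := mul_eq_one_comm.mp hPQ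
  refine ⟨fun i => T i i, ?_, ?_⟩
  · have h1 : T.charpoly = A.charpoly := by
      rw [hTdef, Matrix.charpoly_mul_comm, ← Matrix.mul_assoc, hQP, Matrix.one_mul]
    rw [← h1]
    exact Matrix.charpoly_of_upperTriangular T (fun i j hij => hT i j hij)
  · let F : ℂ → Matrix (Fin n) (Fin n) ℂ := fun s =>
      Matrix.of fun i j => s ^ ((j : ℕ) - (i : ℕ)) * T i j
    have hF0 : F 0 = Matrix.diagonal (fun i => T i i) := by
      ext i j
      rcases lt_trichotomy i j with h | h | h
      · have : (j : ℕ) - (i : ℕ) ≠ 0 := by have : (i : ℕ) < j := h; omega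
        simp [F, Matrix.diagonal_apply_ne _ h.ne, this]
      · subst h; simp [F]
      · simp [F, Matrix.diagonal_apply_ne _ h.ne', hT i j h]
    have hFc : Continuous F := by
      refine continuous_matrix fun i j => ?_
      simp only [F, Matrix.of_apply]
      fun_prop
    have hlim : Filter.Tendsto F (nhdsWithin 0 {0}ᶜ) (nhds (Matrix.diagonal fun i => T i i)) := by
      rw [← hF0]
      exact hFc.continuousAt.tendsto.mono_left nhdsWithin_le_nhds
    refine mem_closure_of_tendsto hlim ?_
    filter_upwards [self_mem_nhdsWithin] with s hs
    have hs0 : s ≠ 0 := hs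
    let D : Matrix (Fin n) (Fin n) ℂ := Matrix.diagonal fun i => (s ^ (i : ℕ))⁻¹
    let D' : Matrix (Fin n) (Fin n) ℂ := Matrix.diagonal fun i => s ^ (i : ℕ)
    have hDD : D * D' = 1 := by
      simp [D, D', Matrix.diagonal_mul_diagonal, hs0]
    have hF : F s = (D * P) * A * (Q * D') := by
      have : (D * P) * A * (Q * D') = D * T * D' := by
        simp only [hTdef, Matrix.mul_assoc]
      rw [this]
      ext i j
      simp only [F, D, D', Matrix.of_apply, Matrix.mul_diagonal, Matrix.diagonal_mul]
      rcases le_or_gt i j with h | h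
      · have h' : (i : ℕ) ≤ j := h
        rw [pow_sub₀ s hs0 h']
        ring
      · simp [hT i j h]
    obtain ⟨g, hg⟩ := sl_aux n A (D * P) (Q * D') (by
      calc D * P * (Q * D') = D * (P * Q) * D' := by simp only [Matrix.mul_assoc]
        _ = 1 := by rw [hPQ, Matrix.mul_one, hDD])
    exact ⟨g, hF.trans hg⟩
end

section
/- Let N ≥ 1 be a positive integer. For all real numbers x₁, …, x_N one has 2·max{Σᵢ xᵢ, −2·Σᵢ xᵢ} + (1/2)·Σᵢ log(4·e^{−4xᵢ} + 4·e^{2xᵢ} + e^{8xᵢ}) ≥ N·log 3. -/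
/-- Let `N ≥ 1`.  For all real numbers `x₁, …, x_N` one has
`2·max{∑ᵢ xᵢ, −2·∑ᵢ xᵢ} + (1/2)·∑ᵢ log(4·e^(−4xᵢ) + 4·e^(2xᵢ) + e^(8xᵢ)) ≥ N·log 3`. -/
theorem convexity_lemma_weights
    (N : ℕ) (hN : 1 ≤ N) (x : Fin N → ℝ) :
    2 * max (∑ i, x i) (-(2 * ∑ i, x i)) +
        (1 / 2) * ∑ i, Real.log
          (4 * Real.exp (-(4 * x i)) + 4 * Real.exp (2 * x i) + Real.exp (8 * x i)) ≥
      N * Real.log 3 := by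
  have h9 : Real.log 9 = 2 * Real.log 3 := by
    rw [show (9 : ℝ) = 3 ^ 2 by norm_num, Real.log_pow]
    norm_num
  have hterm : ∀ i ∈ (Finset.univ : Finset (Fin N)), 2 * Real.log 3 ≤ Real.log
      (4 * Real.exp (-(4 * x i)) + 4 * Real.exp (2 * x i) + Real.exp (8 * x i)) := by
    intro i _
    rw [← h9]
    apply Real.log_le_log (by norm_num)
    linarith [Real.add_one_le_exp (-(4 * x i)), Real.add_one_le_exp (2 * x i),
      Real.add_one_le_exp (8 * x i)]
  have hsum := Finset.sum_le_sum hterm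
  rw [Finset.sum_const, Finset.card_univ, Fintype.card_fin, nsmul_eq_mul] at hsum
  have h1 := le_max_left (∑ i, x i) (-(2 * ∑ i, x i))
  have h2 := le_max_right (∑ i, x i) (-(2 * ∑ i, x i))
  linarith
end

section
/- Let N ≥ 1 be a positive integer. For all real numbers x₁, …, x_N one has max{0, −Σᵢ xᵢ} + (1/2)·Σᵢ log(2 + e^{2xᵢ}) ≥ N·log √3. -/
theorem aux_tangent (t : ℝ) :
    Real.log 3 + 2 * t / 3 ≤ Real.log (2 + Real.exp (2 * t)) := by
  have h1 : Real.exp (2 * t) = Real.exp (2 * t / 3) ^ 3 := by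
    rw [← Real.exp_nat_mul]; congr 1; push_cast; ring
  have hu := Real.exp_pos (2 * t / 3)
  have h2 : Real.log 3 + 2 * t / 3 = Real.log (3 * Real.exp (2 * t / 3)) := by
    rw [Real.log_mul (by norm_num) hu.ne', Real.log_exp]
  rw [h2, h1]
  apply Real.log_le_log (by positivity)
  nlinarith [mul_nonneg (sq_nonneg (Real.exp (2 * t / 3) - 1))
    (by linarith : (0 : ℝ) ≤ Real.exp (2 * t / 3) + 2)]

/-- Let `N ≥ 1`.  For all real numbers `x₁, …, x_N` one has
`max{0, −∑ᵢ xᵢ} + (1/2)·∑ᵢ log(2 + e^(2xᵢ)) ≥ N·log √3`. -/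
theorem convexity_lemma_unipotent
    (N : ℕ) (hN : 1 ≤ N) (x : Fin N → ℝ) :
    max 0 (-(∑ i, x i)) + (1 / 2) * ∑ i, Real.log (2 + Real.exp (2 * x i)) ≥
      N * Real.log (Real.sqrt 3) := by
  have h : ∑ i, (Real.log 3 + 2 * x i / 3) ≤ ∑ i, Real.log (2 + Real.exp (2 * x i)) :=
    Finset.sum_le_sum fun i _ => aux_tangent (x i)
  rw [Finset.sum_add_distrib, ← Finset.sum_div, ← Finset.mul_sum, Finset.sum_const,
    Finset.card_univ, Fintype.card_fin, nsmul_eq_mul] at h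
  rw [Real.log_sqrt (by norm_num)]
  have h0 := le_max_left 0 (-(∑ i, x i))
  have h1 := le_max_right 0 (-(∑ i, x i))
  linarith
end

section
/- Let X and Y be locally compact Hausdorff topological spaces and let f : X → Y be a continuous surjective map such that the preimage of every compact subset of Y is compact. Let u : X → [−∞, +∞) be an upper semicontinuous function. Then the function f_↑u : Y → [−∞, +∞) defined by f_↑u(y) = sup{u(x) : f(x) = y} is well defined (never takes the value +∞) and upper semicontinuous. -/
/-- Let `X`, `Y` be locally compact Hausdorff spaces and `f : X → Y` a continuous surjective
map such that the preimage of every compact set is compact.  Let `u : X → [−∞, +∞)` be upper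
semicontinuous.  Then `f_↑u : y ↦ sup {u x : f x = y}` never takes the value `+∞` and is
upper semicontinuous. -/
theorem upperSemicontinuous_sup_along_fibers
    {X Y : Type*} [TopologicalSpace X] [T2Space X] [LocallyCompactSpace X]
    [TopologicalSpace Y] [T2Space Y] [LocallyCompactSpace Y]
    (f : X → Y) (hf : Continuous f) (hsurj : Function.Surjective f)
    (hproper : ∀ K : Set Y, IsCompact K → IsCompact (f ⁻¹' K))
    (u : X → EReal) (husc : UpperSemicontinuous u) (hfin : ∀ x, u x ≠ ⊤) :
    (∀ y : Y, (⨆ x ∈ f ⁻¹' {y}, u x) ≠ ⊤) ∧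
    UpperSemicontinuous (fun y : Y => ⨆ x ∈ f ⁻¹' {y}, u x) := by
  have hmax : ∀ y : Y, ∃ x, f x = y ∧ (⨆ x ∈ f ⁻¹' {y}, u x) = u x := by
    intro y
    obtain ⟨x₀, hx₀⟩ := hsurj y
    obtain ⟨x, hx, hm⟩ := UpperSemicontinuousOn.exists_isMaxOn (s := f ⁻¹' {y}) ⟨x₀, hx₀⟩
      (hproper _ isCompact_singleton) (husc.upperSemicontinuousOn _)
    exact ⟨x, hx, le_antisymm (iSup₂_le fun z hz => hm hz) (le_iSup₂ (f := fun z _ => u z) x hx)⟩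
  have hclosed : IsClosedMap f :=
    (isProperMap_iff_isCompact_preimage.mpr ⟨hf, fun {K} hK => hproper K hK⟩).isClosedMap
  refine ⟨fun y => ?_, ?_⟩
  · obtain ⟨x, -, hx⟩ := hmax y
    rw [hx]
    exact hfin x
  · rw [upperSemicontinuous_iff_isOpen_preimage]
    intro c
    have hopen := isClosedMap_iff_kernImage.mp hclosed (husc.isOpen_preimage c)
    convert hopen using 1
    ext y
    constructor
    · intro hy x hx
      exact lt_of_le_of_lt (le_iSup₂ (f := fun z (_ : z ∈ f ⁻¹' {y}) => u z) x hx) hy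
    · intro hy
      obtain ⟨x, hxy, hx⟩ := hmax y
      change (⨆ x ∈ f ⁻¹' {y}, u x) < c
      rw [hx]
      exact hy hxy
end

section
/- Let X and Y be locally compact Hausdorff topological spaces and let f : X → Y be a continuous surjective map such that the preimage of every compact subset of Y is compact. Let u : X → [−∞, +∞) be an upper semicontinuous function such that for every α ∈ ℝ the set {x ∈ X : u(x) ≥ α} is compact. Then for every α ∈ ℝ the set {y ∈ Y : f_↑u(y) ≥ α} is compact, where f_↑u(y) = sup{u(x) : f(x) = y}. -/
/-- Let `X`, `Y` be locally compact Hausdorff spaces and `f : X → Y` a continuous surjective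
map such that the preimage of every compact set is compact.  Let `u : X → [−∞, +∞)` be upper
semicontinuous and topologically proper, i.e. `{u ≥ α}` is compact for every real `α`.  Then
for every real `α` the set `{y : f_↑u y ≥ α}` is compact, where
`f_↑u y = sup {u x : f x = y}`. -/
theorem proper_sup_along_fibers
    {X Y : Type*} [TopologicalSpace X] [T2Space X] [LocallyCompactSpace X]
    [TopologicalSpace Y] [T2Space Y] [LocallyCompactSpace Y]
    (f : X → Y) (hf : Continuous f) (hsurj : Function.Surjective f)
    (hproper : ∀ K : Set Y, IsCompact K → IsCompact (f ⁻¹' K))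
    (u : X → EReal) (husc : UpperSemicontinuous u) (hfin : ∀ x, u x ≠ ⊤)
    (hu : ∀ α : ℝ, IsCompact {x : X | (α : EReal) ≤ u x}) :
    ∀ α : ℝ, IsCompact {y : Y | (α : EReal) ≤ ⨆ x ∈ f ⁻¹' {y}, u x} := by
  intro α
  have key : {y : Y | (α : EReal) ≤ ⨆ x ∈ f ⁻¹' {y}, u x} = f '' {x : X | (α : EReal) ≤ u x} := by
    ext y
    constructor
    · intro hy
      obtain ⟨x, hx, hmax⟩ := (husc.upperSemicontinuousOn (f ⁻¹' {y})).exists_isMaxOn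
        (hsurj y) (hproper {y} isCompact_singleton)
      have h1 : (⨆ z ∈ f ⁻¹' {y}, u z) ≤ u x := iSup₂_le fun z hz => hmax hz
      have h2 : (α : EReal) ≤ u x := le_trans hy h1
      exact ⟨x, h2, hx⟩
    · rintro ⟨x, hx, hxy⟩
      have hm : x ∈ f ⁻¹' {y} := hxy
      have h1 : u x ≤ ⨆ z ∈ f ⁻¹' {y}, u z := le_iSup₂ (f := fun z (_ : z ∈ f ⁻¹' {y}) => u z) x hm
      have h2 : (α : EReal) ≤ u x := hx
      exact le_trans h2 h1
  rw [key]
  exact (hu α).image hf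
end

section
/- Let a, b, c, d be complex numbers with ad − bc = 1, let g be the 2×2 matrix with rows (a, c) and (b, d), and let φ be the 2×2 matrix with rows (1, 1) and (0, 1). Then g φ g⁻¹ is the matrix with rows (1 − ab, a²) and (−b², 1 + ab), and its squared Frobenius norm equals 2 + (|a|² + |b|²)²; in particular ‖g φ g⁻¹‖_F ≥ √2 for every g ∈ SL₂(ℂ), with value √3 for g the identity. -/
/-- Let `a, b, c, d ∈ ℂ` with `ad − bc = 1`, let `g = !![a, c; b, d]` and let
`φ = !![1, 1; 0, 1]`.  Then `g φ g⁻¹ = !![1 − ab, a²; −b², 1 + ab]`, its squared Frobenius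
norm equals `2 + (|a|² + |b|²)²`; in particular `‖g φ g⁻¹‖_F ≥ √2` for every `g ∈ SL₂(ℂ)`,
with value `√3` for `g` the identity (i.e. `‖φ‖_F = √3`). -/
theorem conj_unipotent_frobenius
    (a b c d : ℂ) (h : a * d - b * c = 1) :
    !![a, c; b, d] * !![(1 : ℂ), 1; 0, 1] * (!![a, c; b, d])⁻¹ =
        !![1 - a * b, a ^ 2; -b ^ 2, 1 + a * b] ∧
    frobeniusNorm (!![a, c; b, d] * !![(1 : ℂ), 1; 0, 1] * (!![a, c; b, d])⁻¹) ^ 2 =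
        2 + (‖a‖ ^ 2 + ‖b‖ ^ 2) ^ 2 ∧
    frobeniusNorm (!![a, c; b, d] * !![(1 : ℂ), 1; 0, 1] * (!![a, c; b, d])⁻¹) ≥
        Real.sqrt 2 ∧
    frobeniusNorm !![(1 : ℂ), 1; 0, 1] = Real.sqrt 3 := by
  have hinv : (!![a, c; b, d])⁻¹ = !![d, -c; -b, a] := by
    apply Matrix.inv_eq_right_inv
    ext i j
    fin_cases i <;> fin_cases j <;> simp [Matrix.mul_apply, Fin.sum_univ_two] <;> grind
  have hM : !![a, c; b, d] * !![(1 : ℂ), 1; 0, 1] * (!![a, c; b, d])⁻¹ =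
      !![1 - a * b, a ^ 2; -b ^ 2, 1 + a * b] := by
    rw [hinv]
    ext i j
    fin_cases i <;> fin_cases j <;> simp [Matrix.mul_apply, Fin.sum_univ_two] <;> grind
  have hs : ∑ i, ∑ j, ‖(!![1 - a * b, a ^ 2; -b ^ 2, 1 + a * b] : Matrix (Fin 2) (Fin 2) ℂ) i j‖ ^ 2
      = 2 + (‖a‖ ^ 2 + ‖b‖ ^ 2) ^ 2 := by
    have hp := parallelogram_law_with_norm ℝ (1 : ℂ) (a * b)
    rw [norm_mul, norm_one] at hp
    simp only [Fin.sum_univ_two, Matrix.of_apply, Matrix.cons_val', Matrix.cons_val_zero,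
      Matrix.cons_val_one, Matrix.cons_val_fin_one, norm_neg, norm_pow]
    linear_combination hp
  refine ⟨hM, ?_, ?_, ?_⟩
  · rw [hM, frobeniusNorm, hs, Real.sq_sqrt (by positivity)]
  · rw [hM, frobeniusNorm, hs]
    exact Real.sqrt_le_sqrt (by linarith [sq_nonneg (‖a‖ ^ 2 + ‖b‖ ^ 2)])
  · rw [frobeniusNorm]
    congr 1
    simp [Fin.sum_univ_two]
    norm_num
end

section
/- Let k be a field which is algebraically closed and complete with respect to a nontrivial non-archimedean absolute value, and let k° = {x ∈ k : |x| ≤ 1} be its ring of integers. Let A be a flat k°-algebra of finite type such that the structural morphism Spec A → Spec k° is surjective (i.e. every prime of k° is the contraction of a prime of A). Then there exists a k°-algebra homomorphism A → k°; equivalently, the structural morphism Spec A → Spec k° admits a section. -/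
/-- The ring of integers `k° = {x ∈ k : ‖x‖ ≤ 1}` of a nonarchimedean (ultrametric) normed
field `k`, as a subring of `k`. -/
def integerSubring (k : Type*) [NormedField k] [IsUltrametricDist k] : Subring k where
  carrier := {x : k | ‖x‖ ≤ 1}
  mul_mem' := fun {a b} ha hb => by
    simp only [Set.mem_setOf_eq, norm_mul] at *
    nlinarith [norm_nonneg a, norm_nonneg b]
  one_mem' := by simp
  add_mem' := fun {a b} ha hb =>
    le_trans (IsUltrametricDist.norm_add_le_max a b) (max_le ha hb)
  zero_mem' := by simp
  neg_mem' := fun {a} ha => by simpa using ha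

open MvPolynomial

lemma aux_mvPoly_normal {R : Type*} [CommRing R] [IsDomain R] [IsIntegrallyClosed R] (n : ℕ) :
    IsIntegrallyClosed (MvPolynomial (Fin n) R) := by
  induction n with
  | zero => exact .of_equiv (MvPolynomial.isEmptyRingEquiv R (Fin 0)).symm
  | succ n ih => exact .of_equiv (MvPolynomial.finSuccEquiv R n).symm.toRingEquiv

lemma aux_exists_dvd {R ι : Type*} [CommRing R] [IsDomain R] [ValuationRing R] (f : ι → R)
    (s : Finset ι) (hs : s.Nonempty) : ∃ a ∈ s, ∀ b ∈ s, f a ∣ f b := by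
  induction hs using Finset.Nonempty.cons_induction with
  | singleton a => exact ⟨a, by simp⟩
  | cons a s ha hs ih =>
    obtain ⟨c, hc, h⟩ := ih
    rcases ValuationRing.dvd_total (f a) (f c) with h1 | h1
    · refine ⟨a, by simp, fun b hb => ?_⟩
      rcases Finset.mem_cons.1 hb with rfl | hb
      · exact dvd_rfl
      · exact h1.trans (h b hb)
    · refine ⟨c, by simp [hc], fun b hb => ?_⟩
      rcases Finset.mem_cons.1 hb with rfl | hb
      · exact h1
      · exact h b hb

lemma aux_factor {R σ : Type*} [CommRing R] [IsDomain R] [ValuationRing R] (P : MvPolynomial σ R)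
    (hP : P ≠ 0) : ∃ c : R, c ≠ 0 ∧ ∃ Q : MvPolynomial σ R, P = C c * Q ∧ ∃ d, Q.coeff d = 1 := by
  obtain ⟨d, hd, h⟩ := aux_exists_dvd P.coeff P.support (by simpa using hP)
  have h0 : P.coeff d ≠ 0 := by simpa using hd
  have : C (P.coeff d) ∣ P := by
    rw [C_dvd_iff_dvd_coeff]
    intro i
    by_cases hi : i ∈ P.support
    · exact h i hi
    · rw [notMem_support_iff.1 hi]; exact dvd_zero _
  obtain ⟨Q, hQ⟩ := this
  refine ⟨_, h0, Q, hQ, d, ?_⟩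
  have := congrArg (coeff d) hQ
  rw [coeff_C_mul] at this
  exact mul_left_cancel₀ h0 (by rw [← this, mul_one])

open IsLocalRing in
/-- Noether normalization of the special fibre, lifted. -/
lemma aux_lift {R A : Type*} [CommRing R] [IsDomain R] [ValuationRing R] [CommRing A] [IsDomain A]
    [Algebra R A] [Algebra.FiniteType R A] (hinj : Function.Injective (algebraMap R A))
    (hm : (maximalIdeal R).map (algebraMap R A) ≠ ⊤) :
    ∃ (n : ℕ) (G : MvPolynomial (Fin n) R →ₐ[R] A), Function.Injective G ∧
      ((Ideal.Quotient.mk ((maximalIdeal R).map (algebraMap R A))).comp G.toRingHom).Finite ∧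
      ∃ p : Ideal A, p.IsPrime ∧ (maximalIdeal R).map (algebraMap R A) ≤ p ∧
        RingHom.ker (constantCoeff (σ := Fin n) (R := R)) ≤ p.comap G := by
  set I := (maximalIdeal R).map (algebraMap R A) with hI
  have : Nontrivial (A ⧸ I) := Ideal.Quotient.nontrivial_iff.2 hm
  let φ : ResidueField R →+* A ⧸ I := Ideal.quotientMap I (algebraMap R A) Ideal.le_comap_map
  let : Algebra (ResidueField R) (A ⧸ I) := φ.toAlgebra
  have : IsScalarTower R (ResidueField R) (A ⧸ I) := .of_algebraMap_eq' rfl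
  have : Algebra.FiniteType (ResidueField R) (A ⧸ I) :=
    .of_restrictScalars_finiteType R _ _
  obtain ⟨n, g, ginj, gfin⟩ := exists_finite_inj_algHom_of_fg (ResidueField R) (A ⧸ I)
  choose y hy using fun i => Ideal.Quotient.mk_surjective (g (X i))
  let G : MvPolynomial (Fin n) R →ₐ[R] A := aeval y
  have key : (Ideal.Quotient.mk I).comp G.toRingHom = g.toRingHom.comp (map (residue R)) := by
    ext x
    · simp [G]
      rfl
    · simp [G, hy]
  refine ⟨n, G, ?_, ?_, ?_⟩
  · rw [injective_iff_map_eq_zero]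
    intro P hP
    by_contra h0
    obtain ⟨c, hc, Q, rfl, d, hd⟩ := aux_factor P h0
    have h1 : G Q = 0 := by
      rw [map_mul] at hP
      refine (mul_eq_zero.1 hP).resolve_left ?_
      simpa [G] using fun h => hc (hinj (by simpa using h))
    have h2 := DFunLike.congr_fun key Q
    simp only [RingHom.comp_apply] at h2
    erw [h1] at h2
    rw [map_zero] at h2
    have h3 : map (residue R) Q = 0 := ginj (h2.symm.trans (map_zero g).symm)
    have h4 := congrArg (coeff d) h3
    simp [coeff_map, hd] at h4
  · rw [key]
    exact RingHom.Finite.comp gfin (.of_surjective _ (map_surjective _ residue_surjective))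
  · have hint : g.toRingHom.IsIntegral := RingHom.Finite.to_isIntegral gfin
    let := g.toRingHom.toAlgebra
    have : Algebra.IsIntegral (MvPolynomial (Fin n) (ResidueField R)) (A ⧸ I) := ⟨hint⟩
    have : (RingHom.ker (constantCoeff (σ := Fin n) (R := ResidueField R))).IsPrime :=
      RingHom.ker_isPrime _
    obtain ⟨Q, -, hQ, hQ'⟩ := Ideal.exists_ideal_over_prime_of_isIntegral
      (RingHom.ker (constantCoeff (σ := Fin n) (R := ResidueField R))) (⊥ : Ideal (A ⧸ I)) (by
        intro x hx
        have : x = 0 := ginj (Eq.trans hx (map_zero g).symm)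
        simp [this])
    refine ⟨Q.comap (Ideal.Quotient.mk I), inferInstance, ?_, ?_⟩
    · intro x hx
      rw [Ideal.mem_comap, Ideal.Quotient.eq_zero_iff_mem.2 hx]
      exact Q.zero_mem
    · intro P hP
      have h2 := DFunLike.congr_fun key P
      have : map (residue R) P ∈ Q.comap (algebraMap (MvPolynomial (Fin n) (ResidueField R)) (A ⧸ I)) := by
        rw [hQ', RingHom.mem_ker, constantCoeff_map, RingHom.mem_ker.1 hP, map_zero]
      rw [Ideal.mem_comap] at this
      change Ideal.Quotient.mk I (G P) ∈ Q
      exact h2 ▸ this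

open IsLocalRing in
lemma aux_zmt {R T A : Type*} [CommRing R] [IsLocalRing R] [CommRing T] [CommRing A] [Algebra R A]
    [Algebra R T] [Algebra T A] [IsScalarTower R T A] [Algebra.FiniteType R A]
    (hfin : ((Ideal.Quotient.mk ((maximalIdeal R).map (algebraMap R A))).comp
      (algebraMap T A)).Finite) (p : Ideal A) [p.IsPrime]
    (hp : (maximalIdeal R).map (algebraMap R A) ≤ p) : Algebra.ZariskisMainProperty T p := by
  have : Algebra.FiniteType T A := .of_restrictScalars_finiteType R _ _
  set I := (maximalIdeal R).map (algebraMap R A) with hI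
  have h1 : I ≤ (p.under T).map (algebraMap T A) := by
    rw [hI, IsScalarTower.algebraMap_eq R T A, ← Ideal.map_map]
    apply Ideal.map_mono
    rw [Ideal.map_le_iff_le_comap, Ideal.under_def, Ideal.comap_comap,
      ← IsScalarTower.algebraMap_eq R T A, ← Ideal.map_le_iff_le_comap]
    exact hp
  have : Module.Finite T (A ⧸ I) :=
    (RingHom.finite_algebraMap (A := T) (B := A ⧸ I)).1 hfin
  have : Module.Finite T (A ⧸ (p.under T).map (algebraMap T A)) :=
    .of_surjective (Ideal.Quotient.factorₐ T h1).toLinearMap (Ideal.Quotient.factor_surjective h1)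
  have hpr : (p.map (Ideal.Quotient.mk ((p.under T).map (algebraMap T A)))).IsPrime := by
    infer_instance
  have : Algebra.WeaklyQuasiFiniteAt T p := by
    unfold Algebra.WeaklyQuasiFiniteAt Algebra.QuasiFiniteAt
    infer_instance
  exact .of_finiteType_of_weaklyQuasiFiniteAt p

/-- If `ψ : B → R` sends `r` to a unit and `B[1/r] = A[1/r]` then it extends to `A`. -/
lemma aux_extend {R B A : Type*} [CommRing R] [CommRing B] [CommRing A] [Algebra R B]
    [Algebra R A] (i : B →ₐ[R] A) (r : B)
    (hb : Function.Bijective (Localization.awayMap i.toRingHom r))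
    (ψ : B →ₐ[R] R) (hr : IsUnit (ψ r)) : Nonempty (A →ₐ[R] R) := by
  let e := RingEquiv.ofBijective _ hb
  let L : Localization.Away r →+* R := IsLocalization.Away.lift (g := ψ.toRingHom) r hr
  let F : A →+* R := L.comp (e.symm.toRingHom.comp (algebraMap A (Localization.Away (i.toRingHom r))))
  refine ⟨{ F with commutes' := fun x => ?_ }⟩
  have h1 : e (algebraMap B _ (algebraMap R B x)) = algebraMap A _ (algebraMap R A x) := by
    change Localization.awayMap i.toRingHom r _ = _
    simp [Localization.awayMap, IsLocalization.Away.map]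
  have h2 : e.symm (algebraMap A _ (algebraMap R A x)) = algebraMap B _ (algebraMap R B x) := by
    rw [← h1, e.symm_apply_apply]
  change L (e.symm (algebraMap A _ (algebraMap R A x))) = _
  rw [h2]
  simp [L]

open IsLocalRing in
/-- The section on an integral extension of the polynomial ring. -/
lemma aux_point {R K : Type*} [CommRing R] [IsDomain R] [IsLocalRing R] [IsIntegrallyClosed R]
    [Field K] [IsAlgClosed K] [Algebra R K] [IsFractionRing R K] {D : Type*} [CommRing D]
    [IsDomain D] [Algebra R D] (hinj : Function.Injective (algebraMap R D))
    [Algebra.IsIntegral R D] (p : Ideal D) (hp : maximalIdeal R ≤ p.comap (algebraMap R D))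
    (r : D) (hr : r ∉ p) : ∃ ψ : D →ₐ[R] R, IsUnit (ψ r) := by
  have : FaithfulSMul R D := (faithfulSMul_iff_algebraMap_injective R D).2 hinj
  have : Module.IsTorsionFree R D := inferInstance
  have : Module.IsTorsionFree R K := inferInstance
  let φ : D →ₐ[R] K := IsAlgClosed.lift
  have hφ : ∀ x, ∃ y : R, algebraMap R K y = φ x := fun x =>
    IsIntegrallyClosed.isIntegral_iff.1 ((Algebra.IsIntegral.isIntegral (R := R) x).map φ)
  let ι : R →ₐ[R] K := Algebra.ofId R K
  have hι : Function.Injective ι := IsFractionRing.injective R K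
  let e := AlgEquiv.ofInjective ι hι
  let ψ : D →ₐ[R] R := e.symm.toAlgHom.comp (φ.codRestrict ι.range hφ)
  refine ⟨ψ, ?_⟩
  by_contra hu
  have hker : RingHom.ker ψ = ⊥ := by
    apply Ideal.eq_bot_of_comap_eq_bot (R := R)
    rw [eq_bot_iff]
    intro x hx
    rw [Ideal.mem_comap, RingHom.mem_ker, AlgHom.commutes] at hx
    exact hx
  have hψ : Function.Injective ψ := (RingHom.injective_iff_ker_eq_bot _).2 hker
  have h1 : r = algebraMap R D (ψ r) := hψ (by rw [AlgHom.commutes]; rfl)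
  exact hr (h1 ▸ hp ((mem_maximalIdeal _).2 hu))

open IsLocalRing in
lemma aux_domain {R K : Type*} [CommRing R] [IsDomain R] [ValuationRing R]
    [Field K] [IsAlgClosed K] [Algebra R K] [IsFractionRing R K] {A : Type*} [CommRing A]
    [IsDomain A] [Algebra R A] [Algebra.FiniteType R A]
    (hinj : Function.Injective (algebraMap R A))
    (hm : (maximalIdeal R).map (algebraMap R A) ≠ ⊤) : Nonempty (A →ₐ[R] R) := by
  obtain ⟨n, G, Ginj, Gfin, p, hp, hmp, hGp⟩ := aux_lift hinj hm
  have := aux_mvPoly_normal (R := R) n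
  let T := MvPolynomial (Fin n) R
  let : Algebra T A := G.toRingHom.toAlgebra
  have : IsScalarTower R T A := .of_algebraMap_eq' G.comp_algebraMap.symm
  obtain ⟨r, hrp, hr⟩ := aux_zmt (R := R) (T := T) Gfin p hmp
  let B := integralClosure T A
  have hTB : Function.Injective (algebraMap T B) := fun x y h =>
    Ginj (congrArg Subtype.val h)
  have : FaithfulSMul T B := (faithfulSMul_iff_algebraMap_injective T B).2 hTB
  let P : Ideal B := p.comap B.val
  have : P.IsPrime := Ideal.IsPrime.comap _
  have : (RingHom.ker (constantCoeff (σ := Fin n) (R := R))).IsPrime := RingHom.ker_isPrime _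
  obtain ⟨q, hqP, hq, hq'⟩ := Ideal.exists_ideal_le_liesOver_of_le (R := T)
    (p := RingHom.ker (constantCoeff (σ := Fin n) (R := R))) (q := P.under T) P hGp
  have hqc : ∀ t : T, algebraMap T B t ∈ q ↔ constantCoeff t = 0 := fun t =>
    (Ideal.mem_of_liesOver q (RingHom.ker (constantCoeff (σ := Fin n) (R := R))) t).symm.trans
      RingHom.mem_ker
  let D := B ⧸ q
  have hTD : ∀ t : T, algebraMap T D t = algebraMap R D (constantCoeff t) := by
    intro t
    have h1 : algebraMap T B (t - C (constantCoeff t)) ∈ q := by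
      rw [hqc]; simp
    rw [map_sub, ← Ideal.Quotient.eq] at h1
    rw [IsScalarTower.algebraMap_apply R T D]
    exact h1
  have hRD : Function.Injective (algebraMap R D) := by
    rw [injective_iff_map_eq_zero]
    intro x hx
    have h1 : algebraMap T D (C x) = 0 := by rw [hTD, constantCoeff_C, hx]
    simpa using (hqc (C x)).1 (Ideal.Quotient.eq_zero_iff_mem.1 h1)
  have : Algebra.IsIntegral T D := inferInstance
  have : Algebra.IsIntegral R D := by
    refine ⟨fun x => ?_⟩
    obtain ⟨f, hf, hfx⟩ := Algebra.IsIntegral.isIntegral (R := T) x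
    refine ⟨f.map constantCoeff, hf.map _, ?_⟩
    rw [Polynomial.eval₂_map, ← hfx]
    congr 1
    exact RingHom.ext fun t => (hTD t).symm
  obtain ⟨ψ, hψ⟩ := aux_point (K := K) hRD (P.map (Ideal.Quotient.mk q)) (by
    intro x hx
    have : algebraMap R B x ∈ P := hmp (Ideal.mem_map_of_mem _ hx)
    exact Ideal.mem_map_of_mem (Ideal.Quotient.mk q) this) (Ideal.Quotient.mk q r) (by
    intro h
    have := (Ideal.mem_quotient_iff_mem hqP).1 h
    exact hrp this)
  exact aux_extend (B.val.restrictScalars R) r hr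
    (ψ.comp ((Ideal.Quotient.mkₐ R q))) hψ

lemma integerSubring_cases {k : Type*} [NormedField k] [IsUltrametricDist k] (x : k) :
    x ∈ integerSubring k ∨ x⁻¹ ∈ integerSubring k := by
  change ‖x‖ ≤ 1 ∨ ‖x⁻¹‖ ≤ 1
  rcases le_total ‖x‖ 1 with h | h
  · exact Or.inl h
  · right; rw [norm_inv]; exact inv_le_one_of_one_le₀ h

lemma integerSubring_isFractionRing (k : Type*) [NormedField k] [IsUltrametricDist k] :
    IsFractionRing (integerSubring k) k :=
  inferInstanceAs (IsFractionRing (⟨integerSubring k, integerSubring_cases⟩ : ValuationSubring k) k)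

lemma integerSubring_valuationRing (k : Type*) [NormedField k] [IsUltrametricDist k] :
    ValuationRing (integerSubring k) :=
  inferInstanceAs (ValuationRing (⟨integerSubring k, integerSubring_cases⟩ : ValuationSubring k))

/-- Let `k` be an algebraically closed field, complete with respect to a nontrivial
nonarchimedean absolute value, with ring of integers `k° = {x : |x| ≤ 1}`.  Let `A` be a flat
`k°`-algebra of finite type such that `Spec A → Spec k°` is surjective.  Then there exists a
`k°`-algebra homomorphism `A → k°`, i.e. the structural morphism admits a section. -/
theorem exists_section_of_flat_finiteType_surjective
    (k : Type*) [NormedField k] [IsUltrametricDist k] [CompleteSpace k] [IsAlgClosed k]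
    (hnontriv : ∃ x : k, x ≠ 0 ∧ ‖x‖ ≠ 1)
    (A : Type*) [CommRing A] [Algebra (integerSubring k) A]
    [Module.Flat (integerSubring k) A] [Algebra.FiniteType (integerSubring k) A]
    (hsurj : Function.Surjective
      (PrimeSpectrum.comap (algebraMap (integerSubring k) A))) :
    Nonempty (A →ₐ[integerSubring k] (integerSubring k)) := by
  have := integerSubring_isFractionRing k
  have := integerSubring_valuationRing k
  obtain ⟨p, hp⟩ := hsurj ⟨IsLocalRing.maximalIdeal (integerSubring k), inferInstance⟩
  have hp1 : IsLocalRing.maximalIdeal (integerSubring k) =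
    p.asIdeal.comap (algebraMap (integerSubring k) A) := (congrArg PrimeSpectrum.asIdeal hp).symm
  have : p.asIdeal.LiesOver (IsLocalRing.maximalIdeal (integerSubring k)) := ⟨hp1⟩
  obtain ⟨q, hqp, hq, hq'⟩ := Ideal.exists_ideal_le_liesOver_of_le (R := integerSubring k)
    (p := ⊥) (q := IsLocalRing.maximalIdeal (integerSubring k)) p.asIdeal bot_le
  have hinj : Function.Injective (algebraMap (integerSubring k) (A ⧸ q)) := by
    rw [injective_iff_map_eq_zero]
    intro x hx
    have : algebraMap (integerSubring k) A x ∈ q := Ideal.Quotient.eq_zero_iff_mem.1 hx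
    exact (Ideal.mem_of_liesOver q ⊥ x).2 this
  have hm : (IsLocalRing.maximalIdeal (integerSubring k)).map
      (algebraMap (integerSubring k) (A ⧸ q)) ≠ ⊤ := by
    intro h
    have h1 : (IsLocalRing.maximalIdeal (integerSubring k)).map
      (algebraMap (integerSubring k) (A ⧸ q)) ≤ p.asIdeal.map (Ideal.Quotient.mk q) := by
      rw [Ideal.map_le_iff_le_comap]
      intro x hx
      rw [hp1] at hx
      exact Ideal.mem_map_of_mem (Ideal.Quotient.mk q) hx
    rw [h] at h1
    have h2 : Ideal.Quotient.mk q 1 ∈ p.asIdeal.map (Ideal.Quotient.mk q) := h1 trivial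
    exact p.2.one_notMem ((Ideal.mem_quotient_iff_mem hqp).1 h2)
  obtain ⟨f⟩ := aux_domain (K := k) hinj hm
  exact ⟨f.comp (Ideal.Quotient.mkₐ _ q)⟩
end
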